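/- In the sparse linear regression model over the SNR-constrained sparse class Θ(k,τ), in the low signal-to-noise regime where k/p → 0, k/n → 0 and τ/σ → 0, there exists a sequence of tuning parameters λ_n > 0 such that the ridge regression estimator β̂_λ = (XᵀX + λ I_p)^{-1} Xᵀ y attains both the first- and second-order terms of the minimax risk: sup_{β ∈ Θ(k,τ)} E‖β̂_λ − β‖₂² = k τ² ( 1 − (k τ²)/(p σ²) · (1 + o(1)) ). -/

import Mathlib

open MeasureTheory ProbabilityTheory Filter Matrix
open scoped NNReal ENNReal Classical

noncomputable section

/-- Number of nonzero entries of a vector (the ℓ₀ "norm"). -/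
def sparsity {m : ℕ} (β : Fin m → ℝ) : ℕ := (Finset.univ.filter fun j => β j ≠ 0).card

/-- The SNR-constrained sparse class `Θ(k,τ) = {β : ‖β‖₀ ≤ k, ‖β‖₂² ≤ kτ²}`. -/
def sparseSNRClass (p k : ℕ) (τ : ℝ) : Set (Fin p → ℝ) :=
  {β | sparsity β ≤ k ∧ (∑ j, β j ^ 2) ≤ (k : ℝ) * τ ^ 2}

/-- The law of the randomness `(X, ε)` in the Gaussian-design linear regression model:
the design `X ∈ ℝ^{n×p}` has i.i.d. `N(0, 1/n)` entries, and independently the noise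
`ε ∈ ℝⁿ` has i.i.d. `N(0, σ²)` entries. -/
def regLaw (n p : ℕ) (σ : ℝ) : Measure ((Fin n → Fin p → ℝ) × (Fin n → ℝ)) :=
  (Measure.pi fun _ : Fin n => Measure.pi fun _ : Fin p => gaussianReal 0 (n : ℝ≥0)⁻¹).prod
    (Measure.pi fun _ : Fin n => gaussianReal 0 (Real.toNNReal (σ ^ 2)))

/-- The response vector `y = Xβ + ε`. -/
def response {n p : ℕ} (X : Fin n → Fin p → ℝ) (β : Fin p → ℝ) (ε : Fin n → ℝ) :
    Fin n → ℝ :=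
  fun i => (∑ j, X i j * β j) + ε i

/-- The risk `E‖β̂(X, y) − β‖₂²` of an estimator `β̂` at a true coefficient vector `β`,
in the Gaussian-design linear regression model with noise level `σ`. -/
def regRisk (n p : ℕ) (σ : ℝ)
    (est : (Fin n → Fin p → ℝ) × (Fin n → ℝ) → Fin p → ℝ) (β : Fin p → ℝ) : ℝ :=
  ∫ ω, (∑ j, (est (ω.1, response ω.1 β ω.2) j - β j) ^ 2) ∂(regLaw n p σ)

/-- The minimax risk `R(S, σ) = inf_{β̂} sup_{β ∈ S} E‖β̂ − β‖₂²` over a parameter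
class `S`, where the infimum runs over all measurable estimators `β̂ = β̂(X, y)`. -/
def minimaxRisk (n p : ℕ) (σ : ℝ) (S : Set (Fin p → ℝ)) : ℝ :=
  ⨅ est : {f : (Fin n → Fin p → ℝ) × (Fin n → ℝ) → Fin p → ℝ // Measurable f},
    ⨆ β : S, regRisk n p σ est.1 β

/-- The ridge regression estimator `β̂_λ = (XᵀX + λ I_p)⁻¹ Xᵀ y`. -/
def ridge {n p : ℕ} (lam : ℝ) (X : Fin n → Fin p → ℝ) (y : Fin n → ℝ) : Fin p → ℝ :=
  (((Matrix.of X)ᵀ * Matrix.of X + lam • (1 : Matrix (Fin p) (Fin p) ℝ))⁻¹).mulVec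
    ((Matrix.of X)ᵀ.mulVec y)

def ridgeInv {n p : ℕ} (lam : ℝ) (X : Fin n → Fin p → ℝ) : Matrix (Fin p) (Fin p) ℝ :=
  ((Matrix.of X)ᵀ * Matrix.of X + lam • (1 : Matrix (Fin p) (Fin p) ℝ))⁻¹

theorem ridge_isUnit {n p : ℕ} {lam : ℝ} (hl : 0 < lam) (X : Fin n → Fin p → ℝ) :
    IsUnit ((Matrix.of X)ᵀ * Matrix.of X + lam • (1 : Matrix (Fin p) (Fin p) ℝ)) := by
  apply Matrix.PosDef.isUnit
  apply Matrix.PosDef.posSemidef_add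
  · have := Matrix.posSemidef_conjTranspose_mul_self (Matrix.of X)
    simpa using this
  · exact Matrix.PosDef.smul Matrix.PosDef.one hl

theorem ridgeInv_eq {n p : ℕ} {lam : ℝ} (hl : 0 < lam) (X : Fin n → Fin p → ℝ) (β : Fin p → ℝ) :
    (Matrix.of X)ᵀ *ᵥ (Matrix.of X *ᵥ (ridgeInv lam X *ᵥ β)) + lam • (ridgeInv lam X *ᵥ β) = β := by
  have h := Matrix.mul_nonsing_inv _ ((Matrix.isUnit_iff_isUnit_det _).1 (ridge_isUnit hl X))
  have h2 := congrArg (fun M => M *ᵥ β) h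
  simpa [ridgeInv, ← Matrix.mulVec_mulVec, Matrix.add_mulVec, Matrix.smul_mulVec] using h2

theorem ridgeInv_eq' {n p : ℕ} {lam : ℝ} (hl : 0 < lam) (X : Fin n → Fin p → ℝ) (β : Fin p → ℝ) :
    ridgeInv lam X *ᵥ ((Matrix.of X)ᵀ *ᵥ (Matrix.of X *ᵥ β)) + lam • (ridgeInv lam X *ᵥ β) = β := by
  have h := Matrix.nonsing_inv_mul _ ((Matrix.isUnit_iff_isUnit_det _).1 (ridge_isUnit hl X))
  have h2 := congrArg (fun M => M *ᵥ β) h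
  simpa [ridgeInv, ← Matrix.mulVec_mulVec, Matrix.add_mulVec, Matrix.mul_add, Matrix.smul_mulVec, Matrix.add_mulVec] using h2

theorem ridge_err {n p : ℕ} {lam : ℝ} (hl : 0 < lam) (X : Fin n → Fin p → ℝ) (β : Fin p → ℝ)
    (ε : Fin n → ℝ) (j : Fin p) :
    ridge lam X (response X β ε) j - β j
      = (-lam * (ridgeInv lam X *ᵥ β) j) + ∑ i, (ridgeInv lam X *ᵥ X i) j * ε i := by
  have h := congrFun (ridgeInv_eq' hl X β) j
  have h1 : response X β ε = Matrix.of X *ᵥ β + ε := by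
    ext i; simp [response, Matrix.mulVec, dotProduct]
  have h2 : ridge lam X (response X β ε) =
      ridgeInv lam X *ᵥ ((Matrix.of X)ᵀ *ᵥ (Matrix.of X *ᵥ β))
       + ridgeInv lam X *ᵥ ((Matrix.of X)ᵀ *ᵥ ε) := by
    rw [h1, ridge, Matrix.mulVec_add, Matrix.mulVec_add]; rfl
  have h3 : (ridgeInv lam X *ᵥ ((Matrix.of X)ᵀ *ᵥ ε)) j
      = ∑ i, (ridgeInv lam X *ᵥ X i) j * ε i := by
    simp only [Matrix.mulVec, dotProduct, Matrix.transpose_apply, Matrix.of_apply, Finset.mul_sum,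
      Finset.sum_mul]
    rw [Finset.sum_comm]
    simp only [mul_assoc]
  rw [h2, Pi.add_apply, h3]
  simp only [Pi.add_apply, Pi.smul_apply, smul_eq_mul] at h
  linarith

def sqn {m : ℕ} (v : Fin m → ℝ) : ℝ := ∑ j, v j ^ 2

theorem sqn_eq {m : ℕ} (v : Fin m → ℝ) : sqn v = v ⬝ᵥ v := by
  simp [sqn, dotProduct, sq]

theorem sqn_nonneg {m : ℕ} (v : Fin m → ℝ) : 0 ≤ sqn v :=
  Finset.sum_nonneg fun _ _ => sq_nonneg _

theorem vec_bounds {n p : ℕ} {lam : ℝ} (hl : 0 < lam) (X : Fin n → Fin p → ℝ) (β : Fin p → ℝ) :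
    lam ^ 2 * sqn (ridgeInv lam X *ᵥ β) ≤ sqn β ∧
    sqn β - 2 / lam * sqn (Matrix.of X *ᵥ β) ≤ lam ^ 2 * sqn (ridgeInv lam X *ᵥ β) ∧
    lam ^ 2 * sqn (ridgeInv lam X *ᵥ β) ≤ sqn β - 2 / lam * sqn (Matrix.of X *ᵥ β)
      + 3 / lam ^ 2 * sqn ((Matrix.of X)ᵀ *ᵥ (Matrix.of X *ᵥ β)) := by
  have h := ridgeInv_eq hl X β
  set w := ridgeInv lam X *ᵥ β with hw
  clear_value w
  set M := Matrix.of X with hM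
  clear_value M
  obtain ⟨a, ha⟩ : ∃ a, a = M *ᵥ w := ⟨_, rfl⟩
  obtain ⟨s, hs⟩ : ∃ s, s = Mᵀ *ᵥ a := ⟨_, rfl⟩
  obtain ⟨t, ht⟩ : ∃ t, t = M *ᵥ s := ⟨_, rfl⟩
  obtain ⟨r, hr⟩ : ∃ r, r = Mᵀ *ᵥ t := ⟨_, rfl⟩
  have e1 : M *ᵥ β = t + lam • a := by
    rw [← h, ← ha, ← hs, Matrix.mulVec_add, Matrix.mulVec_smul, ← ht, ← ha]
  have e2 : Mᵀ *ᵥ (M *ᵥ β) = r + lam • s := by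
    rw [e1, Matrix.mulVec_add, Matrix.mulVec_smul, ← hr, ← hs]
  have key : ∀ (x : Fin n → ℝ) (y : Fin p → ℝ), x ⬝ᵥ (M *ᵥ y) = (Mᵀ *ᵥ x) ⬝ᵥ y := by
    intro x y
    rw [Matrix.dotProduct_mulVec, Matrix.mulVec_transpose]
  have k1 : a ⬝ᵥ t = s ⬝ᵥ s := by rw [ht, key, ← hs]
  have k2 : a ⬝ᵥ a = s ⬝ᵥ w := by nth_rewrite 2 [ha]; rw [key, ← hs]
  have k3 : t ⬝ᵥ t = r ⬝ᵥ s := by nth_rewrite 2 [ht]; rw [key, ← hr]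
  have eb : β = s + lam • w := by rw [hs, ha, h]
  have n1 : 0 ≤ a ⬝ᵥ a := by rw [← sqn_eq]; exact sqn_nonneg _
  have n2 : 0 ≤ s ⬝ᵥ s := by rw [← sqn_eq]; exact sqn_nonneg _
  have n3 : 0 ≤ t ⬝ᵥ t := by rw [← sqn_eq]; exact sqn_nonneg _
  have n4 : 0 ≤ r ⬝ᵥ r := by rw [← sqn_eq]; exact sqn_nonneg _
  have q1 : sqn (M *ᵥ β) = t ⬝ᵥ t + 2 * lam * (s ⬝ᵥ s) + lam ^ 2 * (a ⬝ᵥ a) := by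
    rw [e1, sqn_eq]
    simp only [add_dotProduct, dotProduct_add, smul_dotProduct, dotProduct_smul, smul_eq_mul]
    rw [dotProduct_comm t a, k1]; ring
  have q2 : sqn (Mᵀ *ᵥ (M *ᵥ β)) = r ⬝ᵥ r + 2 * lam * (t ⬝ᵥ t) + lam ^ 2 * (s ⬝ᵥ s) := by
    rw [e2, sqn_eq]
    simp only [add_dotProduct, dotProduct_add, smul_dotProduct, dotProduct_smul, smul_eq_mul]
    rw [dotProduct_comm s r, k3]; ring
  have q3 : sqn β = s ⬝ᵥ s + 2 * lam * (a ⬝ᵥ a) + lam ^ 2 * (w ⬝ᵥ w) := by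
    rw [sqn_eq, eb]
    simp only [add_dotProduct, dotProduct_add, smul_dotProduct, dotProduct_smul, smul_eq_mul]
    rw [dotProduct_comm w s, k2]; ring
  rw [q1, q2, q3, sqn_eq w]
  refine ⟨by nlinarith [mul_nonneg hl.le n1], ?_, ?_⟩
  · have : 0 ≤ 3 * (s ⬝ᵥ s) + 2 / lam * (t ⬝ᵥ t) := by positivity
    have e : 2 / lam * (t ⬝ᵥ t + 2 * lam * (s ⬝ᵥ s) + lam ^ 2 * (a ⬝ᵥ a))
      = 2 / lam * (t ⬝ᵥ t) + 4 * (s ⬝ᵥ s) + 2 * lam * (a ⬝ᵥ a) := by field_simp; ring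
    rw [e]; linarith
  · have : 0 ≤ 3 / lam ^ 2 * (r ⬝ᵥ r) + 4 / lam * (t ⬝ᵥ t) := by positivity
    have e : 2 / lam * (t ⬝ᵥ t + 2 * lam * (s ⬝ᵥ s) + lam ^ 2 * (a ⬝ᵥ a))
      = 2 / lam * (t ⬝ᵥ t) + 4 * (s ⬝ᵥ s) + 2 * lam * (a ⬝ᵥ a) := by field_simp; ring
    have e' : 3 / lam ^ 2 * (r ⬝ᵥ r + 2 * lam * (t ⬝ᵥ t) + lam ^ 2 * (s ⬝ᵥ s))
      = 3 / lam ^ 2 * (r ⬝ᵥ r) + 6 / lam * (t ⬝ᵥ t) + 3 * (s ⬝ᵥ s) := by field_simp; ring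
    have e2 : 6 / lam * (t ⬝ᵥ t) = 4 / lam * (t ⬝ᵥ t) + 2 / lam * (t ⬝ᵥ t) := by ring
    rw [e, e']; linarith

theorem sum_sqn_rows {n p : ℕ} (X : Fin n → Fin p → ℝ) :
    ∑ i, sqn (X i) = ∑ m, sqn (Matrix.of X *ᵥ Pi.single m 1) := by
  simp only [sqn, Matrix.mulVec_single_one, Matrix.col_apply, Matrix.of_apply]
  exact Finset.sum_comm

theorem sum_sqn_rows2 {n p : ℕ} (X : Fin n → Fin p → ℝ) :
    ∑ i, sqn (Matrix.of X *ᵥ X i) =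
      ∑ m, sqn ((Matrix.of X)ᵀ *ᵥ (Matrix.of X *ᵥ Pi.single m 1)) := by
  simp only [sqn, Matrix.mulVec_single_one]
  simp only [Matrix.mulVec, dotProduct, Matrix.col_apply, Matrix.transpose_apply, Matrix.of_apply,
    sq, Finset.sum_mul_sum]
  have e1 : ∀ i l : Fin n, (∑ j, ∑ m, X l j * X i j * (X l m * X i m)) =
      ∑ m, ∑ j, X l j * X i j * (X l m * X i m) := fun i l => Finset.sum_comm
  calc _ = ∑ i, ∑ m, ∑ l, ∑ j, X l j * X i j * (X l m * X i m) := by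
        refine Finset.sum_congr rfl fun i _ => ?_
        simp only [e1]; exact Finset.sum_comm
    _ = ∑ m, ∑ i, ∑ j, ∑ l, X l j * X i j * (X l m * X i m) := by
        rw [Finset.sum_comm]
        refine Finset.sum_congr rfl fun m _ => Finset.sum_congr rfl fun i _ => Finset.sum_comm
    _ = _ := by
        refine Finset.sum_congr rfl fun m _ => ?_
        rw [Finset.sum_comm]
        refine Finset.sum_congr rfl fun m _ => Finset.sum_congr rfl fun i _ =>
          Finset.sum_congr rfl fun l _ => by ring

abbrev gpi (m : ℕ) (v : ℝ≥0) : Measure (Fin m → ℝ) := Measure.pi fun _ => gaussianReal 0 v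
abbrev gmat (n p : ℕ) (v : ℝ≥0) : Measure (Fin n → Fin p → ℝ) := Measure.pi fun _ => gpi p v

theorem gauss_pow_int (v : ℝ≥0) (k : ℕ) : Integrable (fun x : ℝ => x ^ k) (gaussianReal 0 v) := by
  rcases Nat.eq_zero_or_pos k with rfl | hk
  · simp
  · have h := (memLp_id_gaussianReal (μ := 0) (v := v) (k : ℝ≥0))
    have h2 : MemLp (fun x : ℝ => x) (k : ℝ≥0∞) (gaussianReal 0 v) := by exact_mod_cast h
    have h3 := h2.integrable_norm_pow (by omega)
    refine h3.mono' (by fun_prop) (ae_of_all _ fun x => by simp)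

theorem gauss_fourth : ∃ K : ℝ, 0 ≤ K ∧ ∀ v : ℝ≥0, ∫ x, x ^ 4 ∂(gaussianReal 0 v) = K * (v : ℝ) ^ 2 := by
  refine ⟨∫ x, x ^ 4 ∂(gaussianReal 0 1), integral_nonneg fun x => by positivity, fun v => ?_⟩
  have h : (gaussianReal 0 1).map (fun x => Real.sqrt v * x) = gaussianReal 0 v := by
    rw [gaussianReal_map_const_mul]
    congr 1
    · simp
    · ext; simp
  rw [← h, integral_map (by fun_prop) (by fun_prop)]
  simp only [mul_pow]
  rw [integral_const_mul, mul_comm]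
  congr 1
  calc Real.sqrt v ^ 4 = (Real.sqrt v ^ 2) ^ 2 := by ring
    _ = _ := by rw [Real.sq_sqrt (NNReal.coe_nonneg v)]

theorem gauss_second (v : ℝ≥0) : ∫ x, x ^ 2 ∂(gaussianReal 0 v) = v := by
  have := variance_id_gaussianReal (μ := 0) (v := v)
  rw [variance_eq_integral (by fun_prop)] at this
  simpa using this

theorem gauss_neg (v : ℝ≥0) : MeasurePreserving (fun x : ℝ => -x) (gaussianReal 0 v) (gaussianReal 0 v) :=
  ⟨by fun_prop, by rw [gaussianReal_map_neg, neg_zero]⟩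

theorem gpi_int_pow (m : ℕ) (v : ℝ≥0) (i : Fin m) (k : ℕ) :
    Integrable (fun x : Fin m → ℝ => x i ^ k) (gpi m v) :=
  (measurePreserving_eval (fun _ : Fin m => gaussianReal 0 v) i).integrable_comp_of_integrable
    (gauss_pow_int v k)

theorem gpi_pow (m : ℕ) (v : ℝ≥0) (i : Fin m) (k : ℕ) :
    ∫ x, x i ^ k ∂(gpi m v) = ∫ x, x ^ k ∂(gaussianReal 0 v) :=
  integral_comp_eval (μ := fun _ : Fin m => gaussianReal 0 v) (i := i) (f := fun x : ℝ => x ^ k)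
    (by fun_prop)

theorem gpi_flip (m : ℕ) (v : ℝ≥0) (i : Fin m) (F : (Fin m → ℝ) → ℝ) (hF : Measurable F)
    (h : ∀ x, F (fun j => if j = i then - x j else x j) = - F x) : ∫ x, F x ∂(gpi m v) = 0 := by
  have hm : MeasurePreserving (fun (x : Fin m → ℝ) j => if j = i then - x j else x j)
      (gpi m v) (gpi m v) := by
    refine measurePreserving_pi (fun _ : Fin m => gaussianReal 0 v) (fun _ : Fin m => gaussianReal 0 v)
      (f := fun j x => if j = i then - x else x) fun j => ?_
    by_cases hj : j = i
    · simpa [hj] using gauss_neg v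
    · simp only [hj, if_false]; exact MeasurePreserving.id (gaussianReal 0 v)
  have e : ∫ x, F (fun j => if j = i then - x j else x j) ∂(gpi m v) = ∫ x, F x ∂(gpi m v) := by
    conv_rhs => rw [← hm.map_eq]
    rw [integral_map hm.measurable.aemeasurable hF.aestronglyMeasurable]
  simp only [h, integral_neg] at e
  linarith

theorem gmat_flip (n p : ℕ) (v : ℝ≥0) (i : Fin n) (j : Fin p) (F : (Fin n → Fin p → ℝ) → ℝ)
    (hF : Measurable F)
    (h : ∀ x, F (fun a b => if a = i then (if b = j then - x a b else x a b) else x a b) = - F x) :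
    ∫ x, F x ∂(gmat n p v) = 0 := by
  have hm : MeasurePreserving (fun (x : Fin n → Fin p → ℝ) a b =>
      if a = i then (if b = j then - x a b else x a b) else x a b)
      (gmat n p v) (gmat n p v) := by
    refine measurePreserving_pi (fun _ : Fin n => gpi p v) (fun _ : Fin n => gpi p v)
      (f := fun a x b => if a = i then (if b = j then - x b else x b) else x b) fun a => ?_
    by_cases ha : a = i
    · simp only [ha, if_true]
      refine measurePreserving_pi (fun _ : Fin p => gaussianReal 0 v)
        (fun _ : Fin p => gaussianReal 0 v)
        (f := fun b x => if b = j then - x else x) fun b => ?_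
      by_cases hb : b = j
      · simpa [hb] using gauss_neg v
      · simp only [hb, if_false]; exact MeasurePreserving.id (gaussianReal 0 v)
    · simp only [ha, if_false]; exact MeasurePreserving.id (gpi p v)
  have e : ∫ x, F (fun a b => if a = i then (if b = j then - x a b else x a b) else x a b)
      ∂(gmat n p v) = ∫ x, F x ∂(gmat n p v) := by
    conv_rhs => rw [← hm.map_eq]
    rw [integral_map hm.measurable.aemeasurable hF.aestronglyMeasurable]
  simp only [h, integral_neg] at e
  linarith

theorem gpi_int_mul (m : ℕ) (v : ℝ≥0) (i l : Fin m) :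
    Integrable (fun x : Fin m → ℝ => x i * x l) (gpi m v) := by
  refine ((gpi_int_pow m v i 2).add (gpi_int_pow m v l 2)).mono' (by fun_prop)
    (ae_of_all _ fun x => ?_)
  simp only [Pi.add_apply, Real.norm_eq_abs]
  rw [abs_le]; constructor <;> nlinarith [sq_nonneg (x i - x l), sq_nonneg (x i + x l)]

theorem gpi_mul (m : ℕ) (v : ℝ≥0) (i l : Fin m) :
    ∫ x, x i * x l ∂(gpi m v) = if i = l then (v : ℝ) else 0 := by
  split_ifs with h
  · subst h
    simp only [← sq]
    rw [gpi_pow, gauss_second]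
  · refine gpi_flip m v i _ (by fun_prop) fun x => ?_
    simp [Ne.symm h]

theorem gpi_affine_eq (m : ℕ) (c : ℝ) (a x : Fin m → ℝ) : (c + ∑ i, a i * x i) ^ 2 =
    c ^ 2 + (∑ i, 2 * c * a i * x i ^ 1) + ∑ i, ∑ l, a i * a l * (x i * x l) := by
  rw [add_sq, sq (∑ i, a i * x i), Finset.sum_mul_sum, Finset.mul_sum]
  congr 1
  · congr 1; refine Finset.sum_congr rfl fun i _ => by ring
  · refine Finset.sum_congr rfl fun i _ => Finset.sum_congr rfl fun l _ => by ring

theorem gpi_affine_int (m : ℕ) (v : ℝ≥0) (c : ℝ) (a : Fin m → ℝ) :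
    Integrable (fun x : Fin m → ℝ => (c + ∑ i, a i * x i) ^ 2) (gpi m v) := by
  simp only [gpi_affine_eq]
  exact ((integrable_const _).add (integrable_finsetSum _ fun i _ =>
    (gpi_int_pow m v i 1).const_mul _)).add
    (integrable_finsetSum _ fun i _ => integrable_finsetSum _ fun l _ =>
    (gpi_int_mul m v i l).const_mul _)

theorem gpi_affine (m : ℕ) (v : ℝ≥0) (c : ℝ) (a : Fin m → ℝ) :
    ∫ x, (c + ∑ i, a i * x i) ^ 2 ∂(gpi m v) = c ^ 2 + v * sqn a := by
  simp only [gpi_affine_eq]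
  have h1 : Integrable (fun x : Fin m → ℝ => ∑ i, 2 * c * a i * x i ^ 1) (gpi m v) :=
    integrable_finsetSum _ fun i _ => (gpi_int_pow m v i 1).const_mul _
  have h2 : Integrable (fun x : Fin m → ℝ => ∑ i, ∑ l, a i * a l * (x i * x l)) (gpi m v) :=
    integrable_finsetSum _ fun i _ => integrable_finsetSum _ fun l _ =>
      (gpi_int_mul m v i l).const_mul _
  have h3 : Integrable (fun x : Fin m → ℝ => c ^ 2 + ∑ i, 2 * c * a i * x i ^ 1) (gpi m v) :=
    (integrable_const _).add h1
  rw [integral_add h3 h2, integral_add (integrable_const _) h1,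
    integral_finsetSum _ fun i _ => (gpi_int_pow m v i 1).const_mul _,
    integral_finsetSum _ fun i _ => integrable_finsetSum _ fun l _ =>
      (gpi_int_mul m v i l).const_mul _]
  have e1 : ∀ i, ∫ x : Fin m → ℝ, 2 * c * a i * x i ^ 1 ∂(gpi m v) = 0 := by
    intro i
    rw [integral_const_mul, gpi_pow]; simp
  have e2 : ∀ i, ∫ x : Fin m → ℝ, ∑ l, a i * a l * (x i * x l) ∂(gpi m v) = v * a i ^ 2 := by
    intro i
    rw [integral_finsetSum _ fun l _ => (gpi_int_mul m v i l).const_mul _]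
    simp only [integral_const_mul, gpi_mul]
    simp; ring
  simp only [e1, e2, sqn, Finset.mul_sum]
  simp

theorem gmat_int_pow (n p : ℕ) (v : ℝ≥0) (i : Fin n) (j : Fin p) (k : ℕ) :
    Integrable (fun x : Fin n → Fin p → ℝ => x i j ^ k) (gmat n p v) :=
  (measurePreserving_eval (fun _ : Fin n => gpi p v) i).integrable_comp_of_integrable
    (gpi_int_pow p v j k)

theorem gmat_row (n p : ℕ) (v : ℝ≥0) (i : Fin n) (f : (Fin p → ℝ) → ℝ) (hf : Measurable f) :
    ∫ x, f (x i) ∂(gmat n p v) = ∫ x, f x ∂(gpi p v) :=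
  integral_comp_eval (μ := fun _ : Fin n => gpi p v) (i := i) (f := f) hf.aestronglyMeasurable

theorem gmat_int4 (n p : ℕ) (v : ℝ≥0) (i l r s : Fin n) (a b c d : Fin p) :
    Integrable (fun x : Fin n → Fin p → ℝ => x i a * x l b * (x r c * x s d)) (gmat n p v) := by
  refine ((((gmat_int_pow n p v i a 4).add (gmat_int_pow n p v l b 4)).add
    (gmat_int_pow n p v r c 4)).add (gmat_int_pow n p v s d 4)).mono' (by fun_prop)
    (ae_of_all _ fun x => ?_)
  simp only [Pi.add_apply, Real.norm_eq_abs]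
  rw [abs_le]; constructor <;>
  nlinarith [sq_nonneg (x i a * x l b - x r c * x s d), sq_nonneg (x i a * x l b + x r c * x s d),
    sq_nonneg ((x i a) ^ 2 - x l b ^ 2), sq_nonneg ((x r c) ^ 2 - x s d ^ 2),
    sq_nonneg ((x i a) ^ 2 + x l b ^ 2), sq_nonneg ((x r c) ^ 2 + x s d ^ 2)]

theorem gmat_norm1_int (n p : ℕ) (v : ℝ≥0) (β : Fin p → ℝ) :
    Integrable (fun X : Fin n → Fin p → ℝ => sqn (Matrix.of X *ᵥ β)) (gmat n p v) := by
  simp only [sqn, Matrix.mulVec, dotProduct, Matrix.of_apply]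
  refine integrable_finsetSum _ fun i _ => ?_
  have := (measurePreserving_eval (fun _ : Fin n => gpi p v) i).integrable_comp_of_integrable
    (gpi_affine_int p v 0 β)
  simpa [Function.comp_def, mul_comm] using this

theorem gmat_norm1 (n p : ℕ) (v : ℝ≥0) (β : Fin p → ℝ) :
    ∫ X, sqn (Matrix.of X *ᵥ β) ∂(gmat n p v) = n * v * sqn β := by
  simp only [sqn, Matrix.mulVec, dotProduct, Matrix.of_apply]
  rw [integral_finsetSum]
  · have : ∀ i : Fin n, ∫ X : Fin n → Fin p → ℝ, (∑ j, X i j * β j) ^ 2 ∂(gmat n p v) = v * sqn β := by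
      intro i
      rw [gmat_row n p v i (fun x => (∑ j, x j * β j) ^ 2) (by fun_prop)]
      have := gpi_affine p v 0 β
      simpa [mul_comm] using this
    simp only [this]
    simp [sqn]; ring
  · intro i _
    have := (measurePreserving_eval (fun _ : Fin n => gpi p v) i).integrable_comp_of_integrable
      (gpi_affine_int p v 0 β)
    simpa [Function.comp_def, mul_comm] using this

theorem norm2_eq {n p : ℕ} (X : Fin n → Fin p → ℝ) (β : Fin p → ℝ) :
    sqn ((Matrix.of X)ᵀ *ᵥ (Matrix.of X *ᵥ β)) =
    ∑ j, ∑ i, ∑ l, ∑ m, ∑ m', β m * β m' * (X i j * X l j * (X i m * X l m')) := by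
  simp only [sqn, Matrix.mulVec, dotProduct, Matrix.transpose_apply, Matrix.of_apply]
  refine Finset.sum_congr rfl fun j _ => ?_
  rw [sq, Finset.sum_mul_sum]
  refine Finset.sum_congr rfl fun i _ => Finset.sum_congr rfl fun l _ => ?_
  rw [mul_mul_mul_comm, Finset.sum_mul_sum, Finset.mul_sum]
  refine Finset.sum_congr rfl fun m _ => ?_
  rw [Finset.mul_sum]
  refine Finset.sum_congr rfl fun m' _ => by ring

theorem gmat_norm2_int (n p : ℕ) (v : ℝ≥0) (β : Fin p → ℝ) :
    Integrable (fun X : Fin n → Fin p → ℝ => sqn ((Matrix.of X)ᵀ *ᵥ (Matrix.of X *ᵥ β)))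
      (gmat n p v) := by
  simp only [norm2_eq]
  exact integrable_finsetSum _ fun j _ => integrable_finsetSum _ fun i _ =>
    integrable_finsetSum _ fun l _ => integrable_finsetSum _ fun m _ =>
    integrable_finsetSum _ fun m' _ => (gmat_int4 n p v i l i l j j m m').const_mul _

theorem gmat_term {K : ℝ} (hK0 : 0 ≤ K)
    (hK : ∀ v : ℝ≥0, ∫ x, x ^ 4 ∂(gaussianReal 0 v) = K * (v : ℝ) ^ 2)
    (n p : ℕ) (v : ℝ≥0) (β : Fin p → ℝ) (i l : Fin n) (j m m' : Fin p) :
    β m * β m' * ∫ X, X i j * X l j * (X i m * X l m') ∂(gmat n p v) ≤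
      (if i = l then (if m = m' then K * (v : ℝ) ^ 2 * β m ^ 2 else 0) else 0) +
      (if m = j then (if m' = j then (v : ℝ) ^ 2 * β j ^ 2 else 0) else 0) := by
  have hp2 : 0 ≤ (if m = j then (if m' = j then (v : ℝ) ^ 2 * β j ^ 2 else 0) else 0) := by
    split_ifs <;> positivity
  by_cases hil : i = l
  · subst hil
    by_cases hm : m = m'
    · subst hm
      simp only [if_true]
      have h4 : ∀ a, ∫ X : Fin n → Fin p → ℝ, X i a ^ 4 ∂(gmat n p v) = K * (v : ℝ) ^ 2 := by
        intro a
        rw [gmat_row n p v i (fun x => x a ^ 4) (by fun_prop), gpi_pow, hK]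
      have : ∫ X : Fin n → Fin p → ℝ, X i j * X i j * (X i m * X i m) ∂(gmat n p v) ≤
          ∫ X : Fin n → Fin p → ℝ, (2⁻¹ * X i j ^ 4 + 2⁻¹ * X i m ^ 4) ∂(gmat n p v) := by
        refine integral_mono (gmat_int4 ..) (((gmat_int_pow n p v i j 4).const_mul _).add
          ((gmat_int_pow n p v i m 4).const_mul _)) fun X => ?_
        simp only
        nlinarith [sq_nonneg (X i j ^ 2 - X i m ^ 2)]
      rw [integral_add ((gmat_int_pow n p v i j 4).const_mul _)
          ((gmat_int_pow n p v i m 4).const_mul _), integral_const_mul, integral_const_mul,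
          h4, h4] at this
      nlinarith [sq_nonneg (β m)]
    · rw [gmat_flip n p v i m _ (by fun_prop)]
      · simpa [hm] using hp2
      · intro x
        by_cases hj : j = m <;> simp [hj, Ne.symm hm]
  · by_cases hm : m = j
    · by_cases hm' : m' = j
      · subst hm; subst hm'
        simp only [hil, if_true, if_false, zero_add]
        have hind := (iIndepFun_pi (μ := fun _ : Fin n => gpi p v)
          (X := fun _ x => x m' ^ 2)
          (fun _ => Measurable.aemeasurable (by fun_prop))).indepFun hil
        have := hind.integral_fun_mul_eq_mul_integral
          (Measurable.aestronglyMeasurable (by fun_prop))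
          (Measurable.aestronglyMeasurable (by fun_prop))
        have h2 : ∀ a : Fin n, ∫ X : Fin n → Fin p → ℝ, X a m' ^ 2 ∂(gmat n p v) = v := by
          intro a
          rw [gmat_row n p v a (fun x => x m' ^ 2) (by fun_prop), gpi_pow, gauss_second]
        rw [h2, h2] at this
        have e : ∀ X : Fin n → Fin p → ℝ, X i m' * X l m' * (X i m' * X l m')
          = X i m' ^ 2 * X l m' ^ 2 := fun X => by ring
        simp only [e]
        rw [this]; apply le_of_eq; ring
      · rw [gmat_flip n p v l j _ (by fun_prop)]
        · simp [hil, hm']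
        · intro x
          simp [hil, hm']
    · rw [gmat_flip n p v i j _ (by fun_prop)]
      · simp [hil, hm]
      · intro x
        simp [Ne.symm hil, hm]

theorem gmat_norm2 {K : ℝ} (hK0 : 0 ≤ K)
    (hK : ∀ v : ℝ≥0, ∫ x, x ^ 4 ∂(gaussianReal 0 v) = K * (v : ℝ) ^ 2)
    (n p : ℕ) (v : ℝ≥0) (β : Fin p → ℝ) :
    ∫ X, sqn ((Matrix.of X)ᵀ *ᵥ (Matrix.of X *ᵥ β)) ∂(gmat n p v) ≤
      (n ^ 2 + K * n * p) * (v : ℝ) ^ 2 * sqn β := by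
  simp only [norm2_eq]
  have key : ∫ X : Fin n → Fin p → ℝ, (∑ j, ∑ i, ∑ l, ∑ m, ∑ m',
      β m * β m' * (X i j * X l j * (X i m * X l m'))) ∂(gmat n p v) =
      ∑ j, ∑ i, ∑ l, ∑ m, ∑ m', β m * β m' *
        ∫ X : Fin n → Fin p → ℝ, X i j * X l j * (X i m * X l m') ∂(gmat n p v) := by
    have I : ∀ (j : Fin p) (i l : Fin n) (m m' : Fin p), Integrable (fun X : Fin n → Fin p → ℝ =>
      β m * β m' * (X i j * X l j * (X i m * X l m'))) (gmat n p v) :=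
      fun j i l m m' => (gmat_int4 n p v i l i l j j m m').const_mul _
    rw [integral_finsetSum _ fun j _ => integrable_finsetSum _ fun i _ =>
      integrable_finsetSum _ fun l _ => integrable_finsetSum _ fun m _ =>
      integrable_finsetSum _ fun m' _ => I j i l m m']
    refine Finset.sum_congr rfl fun j _ => ?_
    rw [integral_finsetSum _ fun i _ =>
      integrable_finsetSum _ fun l _ => integrable_finsetSum _ fun m _ =>
      integrable_finsetSum _ fun m' _ => I j i l m m']
    refine Finset.sum_congr rfl fun i _ => ?_
    rw [integral_finsetSum _ fun l _ => integrable_finsetSum _ fun m _ =>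
      integrable_finsetSum _ fun m' _ => I j i l m m']
    refine Finset.sum_congr rfl fun l _ => ?_
    rw [integral_finsetSum _ fun m _ =>
      integrable_finsetSum _ fun m' _ => I j i l m m']
    refine Finset.sum_congr rfl fun m _ => ?_
    rw [integral_finsetSum _ fun m' _ => I j i l m m']
    refine Finset.sum_congr rfl fun m' _ => ?_
    rw [integral_const_mul]
  rw [key]
  calc _ ≤ ∑ j : Fin p, ∑ i : Fin n, ∑ l : Fin n, ∑ m : Fin p, ∑ m' : Fin p,
      ((if i = l then (if m = m' then K * (v : ℝ) ^ 2 * β m ^ 2 else 0) else 0) +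
      (if m = j then (if m' = j then (v : ℝ) ^ 2 * β j ^ 2 else 0) else 0)) :=
        Finset.sum_le_sum fun j _ => Finset.sum_le_sum fun i _ => Finset.sum_le_sum fun l _ =>
        Finset.sum_le_sum fun m _ => Finset.sum_le_sum fun m' _ =>
          gmat_term hK0 hK n p v β i l j m m'
    _ = ∑ j : Fin p, ∑ i : Fin n, ∑ l : Fin n,
      ((if i = l then K * (v : ℝ) ^ 2 * sqn β else 0) + (v : ℝ) ^ 2 * β j ^ 2) := by
        refine Finset.sum_congr rfl fun j _ => Finset.sum_congr rfl fun i _ =>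
          Finset.sum_congr rfl fun l _ => ?_
        simp only [Finset.sum_add_distrib]
        congr 1
        · split_ifs <;> simp [sqn, Finset.mul_sum]
        · simp
    _ = _ := by
        simp only [Finset.sum_add_distrib]
        simp only [Finset.sum_ite_eq, Finset.mem_univ, if_true, Finset.sum_const, Finset.card_univ,
          Fintype.card_fin, nsmul_eq_mul, ← Finset.mul_sum]
        simp only [sqn]; ring

theorem ridgeInv_meas {n p : ℕ} (lam : ℝ) (a b : Fin p) :
    Measurable (fun X : Fin n → Fin p → ℝ => ridgeInv lam X a b) := by
  have hc : Continuous (fun X : Fin n → Fin p → ℝ =>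
      (Matrix.of X)ᵀ * Matrix.of X + lam • (1 : Matrix (Fin p) (Fin p) ℝ)) := by
    have : Continuous (fun X : Fin n → Fin p → ℝ => (Matrix.of X : Matrix (Fin n) (Fin p) ℝ)) :=
      continuous_id
    exact ((this.matrix_transpose).matrix_mul this).add continuous_const
  simp only [ridgeInv, Matrix.inv_def, Matrix.smul_apply, Ring.inverse_eq_inv', smul_eq_mul]
  exact (hc.matrix_det.measurable.inv).mul (hc.matrix_adjugate.matrix_elem a b).measurable

theorem ridgeInv_mulVec_meas {n p : ℕ} (lam : ℝ) (f : (Fin n → Fin p → ℝ) → Fin p → ℝ)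
    (hf : Measurable f) (a : Fin p) :
    Measurable (fun X : Fin n → Fin p → ℝ => (ridgeInv lam X *ᵥ f X) a) := by
  simp only [Matrix.mulVec, dotProduct]
  refine Finset.measurable_sum _ fun b _ => ?_
  exact (ridgeInv_meas lam a b).mul ((measurable_pi_apply b).comp hf)

theorem risk_formula {n p : ℕ} (σ : ℝ) {lam : ℝ} (hl : 0 < lam) (β : Fin p → ℝ) :
    Integrable (fun X : Fin n → Fin p → ℝ => lam ^ 2 * sqn (ridgeInv lam X *ᵥ β) +
      σ ^ 2 * ∑ i, sqn (ridgeInv lam X *ᵥ X i)) (gmat n p (n : ℝ≥0)⁻¹) ∧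
    regRisk n p σ (fun ω => ridge lam ω.1 ω.2) β =
      ∫ X, (lam ^ 2 * sqn (ridgeInv lam X *ᵥ β) +
      σ ^ 2 * ∑ i, sqn (ridgeInv lam X *ᵥ X i)) ∂(gmat n p (n : ℝ≥0)⁻¹) := by
  have hg : Integrable (fun X : Fin n → Fin p → ℝ => lam ^ 2 * sqn (ridgeInv lam X *ᵥ β) +
      σ ^ 2 * ∑ i, sqn (ridgeInv lam X *ᵥ X i)) (gmat n p (n : ℝ≥0)⁻¹) := by
    have hb : Integrable (fun X : Fin n → Fin p → ℝ => sqn β + σ ^ 2 / lam ^ 2 *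
        ∑ m, sqn (Matrix.of X *ᵥ Pi.single m 1)) (gmat n p (n : ℝ≥0)⁻¹) :=
      (integrable_const _).add ((integrable_finsetSum _ fun m _ =>
        gmat_norm1_int n p _ _).const_mul _)
    refine hb.mono' ?_ (ae_of_all _ fun X => ?_)
    · refine Measurable.aestronglyMeasurable ?_
      simp only [sqn]
      refine Measurable.add (Measurable.const_mul (Finset.measurable_sum _ fun j _ =>
        (ridgeInv_mulVec_meas lam _ measurable_const j).pow_const 2) _)
        (Measurable.const_mul (Finset.measurable_sum _ fun i _ => Finset.measurable_sum _ fun j _ =>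
        (ridgeInv_mulVec_meas lam _ (measurable_pi_apply i) j).pow_const 2) _)
    · rw [Real.norm_eq_abs, abs_of_nonneg]
      · refine add_le_add (vec_bounds hl X β).1 ?_
        rw [← sum_sqn_rows, div_mul_eq_mul_div, mul_div_assoc]
        refine mul_le_mul_of_nonneg_left ?_ (sq_nonneg _)
        rw [Finset.sum_div]
        refine Finset.sum_le_sum fun i _ => ?_
        rw [le_div_iff₀ (by positivity), mul_comm]
        exact (vec_bounds hl X (X i)).1
      · have := sqn_nonneg (ridgeInv lam X *ᵥ β)
        have := Finset.sum_nonneg fun i (_ : i ∈ Finset.univ) => sqn_nonneg (ridgeInv lam X *ᵥ X i)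
        positivity
  refine ⟨hg, ?_⟩
  have hin : ∀ X : Fin n → Fin p → ℝ,
      Integrable (fun ε : Fin n → ℝ => ∑ j, ((-lam * (ridgeInv lam X *ᵥ β) j) +
        ∑ i, (ridgeInv lam X *ᵥ X i) j * ε i) ^ 2) (gpi n (Real.toNNReal (σ ^ 2))) := by
    intro X
    exact integrable_finsetSum _ fun j _ => gpi_affine_int n _ _ _
  have hval : ∀ X : Fin n → Fin p → ℝ,
      ∫ ε : Fin n → ℝ, ∑ j, ((-lam * (ridgeInv lam X *ᵥ β) j) +
        ∑ i, (ridgeInv lam X *ᵥ X i) j * ε i) ^ 2 ∂(gpi n (Real.toNNReal (σ ^ 2))) =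
      lam ^ 2 * sqn (ridgeInv lam X *ᵥ β) + σ ^ 2 * ∑ i, sqn (ridgeInv lam X *ᵥ X i) := by
    intro X
    rw [integral_finsetSum _ fun j _ => gpi_affine_int n _ _ _]
    simp only [gpi_affine, Finset.sum_add_distrib, ← Finset.mul_sum,
      Real.coe_toNNReal _ (sq_nonneg σ)]
    congr 1
    · simp [sqn, mul_pow, Finset.mul_sum]
    · simp only [sqn]; rw [Finset.sum_comm]
  rw [regRisk]
  simp only [ridge_err hl]
  have hf : Integrable (fun ω : (Fin n → Fin p → ℝ) × (Fin n → ℝ) =>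
      ∑ j, ((-lam * (ridgeInv lam ω.1 *ᵥ β) j) +
        ∑ i, (ridgeInv lam ω.1 *ᵥ ω.1 i) j * ω.2 i) ^ 2) (regLaw n p σ) := by
    rw [regLaw, integrable_prod_iff]
    · refine ⟨ae_of_all _ fun X => hin X, ?_⟩
      refine hg.congr (ae_of_all _ fun X => ?_)
      simp only
      rw [← hval X]
      refine integral_congr_ae (ae_of_all _ fun ε => ?_)
      simp only
      rw [Real.norm_eq_abs, abs_of_nonneg]
      positivity
    · refine Measurable.aestronglyMeasurable ?_
      refine Finset.measurable_sum _ fun j _ => Measurable.pow_const ?_ 2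
      refine Measurable.add (Measurable.const_mul
        ((ridgeInv_mulVec_meas lam _ measurable_const j).comp measurable_fst) _) ?_
      refine Finset.measurable_sum _ fun i _ => Measurable.mul
        ((ridgeInv_mulVec_meas lam _ (measurable_pi_apply i) j).comp measurable_fst) ?_
      exact (measurable_pi_apply i).comp measurable_snd
  rw [regLaw] at hf ⊢
  rw [integral_prod _ hf]
  exact integral_congr_ae (ae_of_all _ fun X => hval X)

theorem sqn_single {p : ℕ} (m : Fin p) : sqn (Pi.single m (1 : ℝ)) = 1 := by
  simp [sqn, Pi.single_apply]

theorem risk_bounds {K : ℝ} (hK0 : 0 ≤ K)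
    (hK : ∀ v : ℝ≥0, ∫ x, x ^ 4 ∂(gaussianReal 0 v) = K * (v : ℝ) ^ 2)
    {n p : ℕ} (hn : 0 < n) (σ : ℝ) {lam : ℝ} (hl : 0 < lam) (β : Fin p → ℝ) :
    regRisk n p σ (fun ω => ridge lam ω.1 ω.2) β ≤
      sqn β * (1 - 2 / lam + 3 / lam ^ 2 * (1 + K * p / n)) + σ ^ 2 * p / lam ^ 2 ∧
    sqn β * (1 - 2 / lam) + σ ^ 2 * p / lam ^ 2 * (1 - 2 / lam * (1 + K * p / n)) ≤
      regRisk n p σ (fun ω => ridge lam ω.1 ω.2) β := by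
  obtain ⟨hg, hr⟩ := risk_formula (n := n) σ hl β
  rw [hr]
  have hn' : (n : ℝ) ≠ 0 := by positivity
  have N1 : ∀ β : Fin p → ℝ, ∫ X, sqn (Matrix.of X *ᵥ β) ∂(gmat n p (n : ℝ≥0)⁻¹) = sqn β := by
    intro β; rw [gmat_norm1]; push_cast; field_simp
  have N2 : ∀ β : Fin p → ℝ, ∫ X, sqn ((Matrix.of X)ᵀ *ᵥ (Matrix.of X *ᵥ β))
      ∂(gmat n p (n : ℝ≥0)⁻¹) ≤ (1 + K * p / n) * sqn β := by
    intro β; refine (gmat_norm2 hK0 hK n p _ β).trans (le_of_eq ?_); push_cast; field_simp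
  have I1 := fun β : Fin p → ℝ => gmat_norm1_int n p (n : ℝ≥0)⁻¹ β
  have I2 := fun β : Fin p → ℝ => gmat_norm2_int n p (n : ℝ≥0)⁻¹ β
  have IS1 : Integrable (fun X : Fin n → Fin p → ℝ => ∑ m : Fin p, sqn (Matrix.of X *ᵥ Pi.single m 1))
      (gmat n p (n : ℝ≥0)⁻¹) := integrable_finsetSum _ fun m _ => I1 _
  have IS2 : Integrable (fun X : Fin n → Fin p → ℝ => ∑ m : Fin p,
      sqn ((Matrix.of X)ᵀ *ᵥ (Matrix.of X *ᵥ Pi.single m 1)))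
      (gmat n p (n : ℝ≥0)⁻¹) := integrable_finsetSum _ fun m _ => I2 _
  have S1 : ∫ X : Fin n → Fin p → ℝ, ∑ m : Fin p, sqn (Matrix.of X *ᵥ Pi.single m 1)
      ∂(gmat n p (n : ℝ≥0)⁻¹) = p := by
    rw [integral_finsetSum _ fun m _ => I1 _]
    simp only [N1, sqn_single]
    simp
  have S2 : ∫ X : Fin n → Fin p → ℝ, ∑ m : Fin p,
      sqn ((Matrix.of X)ᵀ *ᵥ (Matrix.of X *ᵥ Pi.single m 1))
      ∂(gmat n p (n : ℝ≥0)⁻¹) ≤ p * (1 + K * p / n) := by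
    rw [integral_finsetSum _ fun m _ => I2 _]
    refine (Finset.sum_le_sum fun m _ => N2 _).trans (le_of_eq ?_)
    simp [sqn_single]
    ring
  constructor
  · have hU : Integrable (fun X : Fin n → Fin p → ℝ =>
        ((sqn β - 2 / lam * sqn (Matrix.of X *ᵥ β)) +
        3 / lam ^ 2 * sqn ((Matrix.of X)ᵀ *ᵥ (Matrix.of X *ᵥ β))) +
        σ ^ 2 / lam ^ 2 * ∑ m : Fin p, sqn (Matrix.of X *ᵥ Pi.single m 1))
        (gmat n p (n : ℝ≥0)⁻¹) :=
      (((integrable_const _).sub ((I1 β).const_mul _)).add ((I2 β).const_mul _)).add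
        (IS1.const_mul _)
    refine (integral_mono hg hU fun X => ?_).trans ?_
    · refine add_le_add (vec_bounds hl X β).2.2 ?_
      rw [← sum_sqn_rows, div_mul_eq_mul_div, mul_div_assoc]
      refine mul_le_mul_of_nonneg_left ?_ (sq_nonneg _)
      rw [Finset.sum_div]
      refine Finset.sum_le_sum fun i _ => ?_
      rw [le_div_iff₀ (by positivity), mul_comm]
      exact (vec_bounds hl X (X i)).1
    · have J1 : Integrable (fun X : Fin n → Fin p → ℝ =>
        (sqn β - 2 / lam * sqn (Matrix.of X *ᵥ β))) (gmat n p (n : ℝ≥0)⁻¹) :=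
        (integrable_const _).sub ((I1 β).const_mul _)
      have J2 : Integrable (fun X : Fin n → Fin p → ℝ =>
        ((sqn β - 2 / lam * sqn (Matrix.of X *ᵥ β)) +
        3 / lam ^ 2 * sqn ((Matrix.of X)ᵀ *ᵥ (Matrix.of X *ᵥ β)))) (gmat n p (n : ℝ≥0)⁻¹) :=
        J1.add ((I2 β).const_mul _)
      rw [integral_add J2 (IS1.const_mul _), integral_add J1 ((I2 β).const_mul _),
        integral_sub (integrable_const _) ((I1 β).const_mul _), integral_const_mul,
        integral_const_mul, integral_const_mul, N1, S1]
      have := mul_le_mul_of_nonneg_left (N2 β) (show 0 ≤ 3 / lam ^ 2 by positivity)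
      simp only [integral_const, probReal_univ, smul_eq_mul, one_mul]
      have e : σ ^ 2 / lam ^ 2 * (p : ℝ) = σ ^ 2 * p / lam ^ 2 := by ring
      rw [e]
      linarith
  · have J1 : Integrable (fun X : Fin n → Fin p → ℝ =>
        (sqn β - 2 / lam * sqn (Matrix.of X *ᵥ β))) (gmat n p (n : ℝ≥0)⁻¹) :=
        (integrable_const _).sub ((I1 β).const_mul _)
    have J2 : Integrable (fun X : Fin n → Fin p → ℝ =>
        σ ^ 2 / lam ^ 2 * ∑ m : Fin p, sqn (Matrix.of X *ᵥ Pi.single m 1) -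
        σ ^ 2 / lam ^ 2 * (2 / lam) * ∑ m : Fin p,
          sqn ((Matrix.of X)ᵀ *ᵥ (Matrix.of X *ᵥ Pi.single m 1))) (gmat n p (n : ℝ≥0)⁻¹) :=
        (IS1.const_mul _).sub (IS2.const_mul _)
    refine le_trans ?_ (integral_mono (J1.add J2) hg fun X => ?_)
    · simp only [Pi.add_apply]
      rw [integral_add J1 J2, integral_sub (integrable_const _) ((I1 β).const_mul _),
        integral_sub (IS1.const_mul _) (IS2.const_mul _), integral_const_mul,
        integral_const_mul, integral_const_mul, N1, S1]
      have := mul_le_mul_of_nonneg_left S2 (show 0 ≤ σ ^ 2 / lam ^ 2 * (2 / lam) by positivity)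
      simp only [integral_const, probReal_univ, smul_eq_mul, one_mul]
      have e : σ ^ 2 * p / lam ^ 2 * (1 - 2 / lam * (1 + K * p / n)) =
        σ ^ 2 / lam ^ 2 * (p : ℝ) - σ ^ 2 / lam ^ 2 * (2 / lam) * (p * (1 + K * p / n)) := by ring
      rw [e]
      linarith
    · refine add_le_add (vec_bounds hl X β).2.1 ?_
      simp only
      rw [← sum_sqn_rows, ← sum_sqn_rows2]
      have : ∑ i, (sqn (X i) - 2 / lam * sqn (Matrix.of X *ᵥ X i)) ≤
          ∑ i, lam ^ 2 * sqn (ridgeInv lam X *ᵥ X i) :=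
        Finset.sum_le_sum fun i _ => (vec_bounds hl X (X i)).2.1
      rw [Finset.sum_sub_distrib, ← Finset.mul_sum, ← Finset.mul_sum] at this
      have h2 := mul_le_mul_of_nonneg_left this (show 0 ≤ σ ^ 2 / lam ^ 2 by positivity)
      have e : σ ^ 2 / lam ^ 2 * (lam ^ 2 * ∑ i, sqn (ridgeInv lam X *ᵥ X i)) =
        σ ^ 2 * ∑ i, sqn (ridgeInv lam X *ᵥ X i) := by field_simp
      rw [e] at h2
      linarith

theorem sup_bounds {K : ℝ} (hK0 : 0 ≤ K)
    (hK : ∀ v : ℝ≥0, ∫ x, x ^ 4 ∂(gaussianReal 0 v) = K * (v : ℝ) ^ 2)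
    {n p k : ℕ} (hn : 0 < n) (hp : 0 < p) (hk : 0 < k) {σ τ : ℝ} (hσ : 0 < σ) (hτ : 0 < τ)
    {lam : ℝ} (hlam : lam = p * σ ^ 2 / (k * τ ^ 2)) (h2 : 2 ≤ lam) :
    (-1 - 2 * ((1 + K * p / n) / lam) ≤
      ((⨆ β : sparseSNRClass p k τ, regRisk n p σ (fun ω => ridge lam ω.1 ω.2) β.1) /
        (k * τ ^ 2) - 1) * lam) ∧
    ((⨆ β : sparseSNRClass p k τ, regRisk n p σ (fun ω => ridge lam ω.1 ω.2) β.1) /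
        (k * τ ^ 2) - 1) * lam ≤ -1 + 3 * ((1 + K * p / n) / lam) := by
  have hl : 0 < lam := by linarith
  obtain ⟨q, hq⟩ : ∃ q : ℝ, q = k * τ ^ 2 := ⟨_, rfl⟩
  have hq0 : 0 < q := by rw [hq]; positivity
  have hs : σ ^ 2 * p = lam * q := by rw [hlam, ← hq]; field_simp
  obtain ⟨c, hc⟩ : ∃ c : ℝ, c = 1 + K * p / n := ⟨_, rfl⟩
  have hc0 : 0 ≤ c := by rw [hc]; positivity
  have hub : ∀ β : sparseSNRClass p k τ, regRisk n p σ (fun ω => ridge lam ω.1 ω.2) β.1 ≤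
      q * (1 - 1 / lam + 3 / lam ^ 2 * c) := by
    intro β
    refine (risk_bounds hK0 hK hn σ hl β.1).1.trans ?_
    have hb : sqn β.1 ≤ q := by rw [hq]; exact β.2.2
    rw [← hc, hs]
    have hnn : 0 ≤ 1 - 2 / lam + 3 / lam ^ 2 * c := by
      have : 2 / lam ≤ 1 := by rw [div_le_one hl]; exact h2
      have : 0 ≤ 3 / lam ^ 2 * c := by positivity
      linarith
    have := mul_le_mul_of_nonneg_right hb hnn
    have e : lam * q / lam ^ 2 = q * (1 / lam) := by field_simp
    have e2 : q * (2 / lam) = 2 * (q * (1 / lam)) := by ring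
    rw [e]
    linarith
  have hz : (0 : Fin p → ℝ) ∈ sparseSNRClass p k τ := by
    refine ⟨by simp [sparsity], by simp; positivity⟩
  haveI : Nonempty (sparseSNRClass p k τ) := ⟨⟨0, hz⟩⟩
  have hU : (⨆ β : sparseSNRClass p k τ, regRisk n p σ (fun ω => ridge lam ω.1 ω.2) β.1) ≤
      q * (1 - 1 / lam + 3 / lam ^ 2 * c) := ciSup_le hub
  have hw : (Pi.single ⟨0, hp⟩ (Real.sqrt q) : Fin p → ℝ) ∈ sparseSNRClass p k τ := by
    constructor
    · refine le_trans ?_ (show 1 ≤ k from hk)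
      rw [sparsity]
      refine (Finset.card_le_card (t := {⟨0, hp⟩}) ?_).trans (by simp)
      intro j hj
      simp only [Finset.mem_filter, Finset.mem_univ, true_and] at hj
      simp only [Finset.mem_singleton]
      by_contra hne
      exact hj (by simp [Pi.single_apply, hne])
    · rw [← hq]
      simp [Pi.single_apply, Real.sq_sqrt hq0.le]
  have hsq : sqn (Pi.single ⟨0, hp⟩ (Real.sqrt q) : Fin p → ℝ) = q := by
    simp [sqn, Pi.single_apply, Real.sq_sqrt hq0.le]
  have hL : q * (1 - 1 / lam - 2 / lam ^ 2 * c) ≤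
      ⨆ β : sparseSNRClass p k τ, regRisk n p σ (fun ω => ridge lam ω.1 ω.2) β.1 := by
    refine le_trans ?_ (le_ciSup (f := fun β : sparseSNRClass p k τ =>
      regRisk n p σ (fun ω => ridge lam ω.1 ω.2) β.1) ⟨_, by rintro _ ⟨β, rfl⟩; exact hub β⟩ ⟨_, hw⟩)
    refine le_trans (le_of_eq ?_) (risk_bounds hK0 hK hn σ hl _).2
    rw [hsq, ← hc, hs]
    field_simp
    ring
  generalize (⨆ β : sparseSNRClass p k τ, regRisk n p σ (fun ω => ridge lam ω.1 ω.2) β.1) = R at *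
  rw [← hq, ← hc]
  have e : (R / q - 1) * lam = (R - q) * (lam / q) := by field_simp
  have hlq : 0 < lam / q := by positivity
  rw [e]
  constructor
  · have := mul_le_mul_of_nonneg_right (sub_le_sub_right hL q) hlq.le
    refine le_trans (le_of_eq ?_) this
    field_simp; ring
  · have := mul_le_mul_of_nonneg_right (sub_le_sub_right hU q) hlq.le
    refine le_trans this (le_of_eq ?_)
    field_simp; ring

/-- **Optimally tuned ridge regression attains the first- and second-order minimax risk
in the low-SNR regime.** Over `Θ(k,τ)`, if `k/p → 0`, `k/n → 0` and `τ/σ → 0` (with `σ`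
fixed), there exist tuning parameters `λ_n > 0` such that
`sup_{β ∈ Θ(k,τ)} E‖β̂_λ − β‖₂² = kτ²(1 − (kτ²)/(pσ²)·(1 + o(1)))`. -/
theorem lowSNR_ridge_second_order
    (σ : ℝ) (hσ : 0 < σ) (p k : ℕ → ℕ) (τ : ℕ → ℝ)
    (hkpos : ∀ n, 0 < k n) (hppos : ∀ n, 0 < p n) (hτpos : ∀ n, 0 < τ n)
    (hkp : Tendsto (fun n : ℕ => (k n : ℝ) / (p n : ℝ)) atTop (nhds 0))
    (hkn : Tendsto (fun n : ℕ => (k n : ℝ) / (n : ℝ)) atTop (nhds 0))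
    (hτσ : Tendsto (fun n : ℕ => τ n / σ) atTop (nhds 0)) :
    ∃ lam : ℕ → ℝ, (∀ n, 0 < lam n) ∧
      Tendsto (fun n : ℕ =>
        (⨆ β : sparseSNRClass (p n) (k n) (τ n),
            regRisk n (p n) σ (fun ω => ridge (lam n) ω.1 ω.2) β.1) /
          ((k n : ℝ) * τ n ^ 2))
        atTop (nhds 1) ∧
      Tendsto (fun n : ℕ =>
        ((⨆ β : sparseSNRClass (p n) (k n) (τ n),
              regRisk n (p n) σ (fun ω => ridge (lam n) ω.1 ω.2) β.1) /
            ((k n : ℝ) * τ n ^ 2) - 1) *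
          (((p n : ℝ) * σ ^ 2) / ((k n : ℝ) * τ n ^ 2)))
        atTop (nhds (-1)) := by
  obtain ⟨K, hK0, hK⟩ := gauss_fourth
  have hlpos : ∀ n, 0 < (p n : ℝ) * σ ^ 2 / (k n * τ n ^ 2) := by
    intro n
    have := hkpos n; have := hppos n; have := hτpos n
    positivity
  refine ⟨fun n => (p n : ℝ) * σ ^ 2 / (k n * τ n ^ 2), hlpos, ?_⟩
  have hts : Tendsto (fun n => (τ n / σ) ^ 2) atTop (nhds 0) := by
    simpa using hτσ.pow 2
  have hinv : Tendsto (fun n => 1 / ((p n : ℝ) * σ ^ 2 / (k n * τ n ^ 2))) atTop (nhds 0) := by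
    have := hkp.mul hts
    rw [mul_zero] at this
    refine this.congr fun n => ?_
    have := hkpos n; have := hppos n; have := hτpos n
    field_simp
  have hc : Tendsto (fun n : ℕ => (1 + K * p n / n) / ((p n : ℝ) * σ ^ 2 / (k n * τ n ^ 2)))
      atTop (nhds 0) := by
    have := hinv.add ((hkn.mul hts).const_mul K)
    rw [mul_zero, mul_zero, add_zero] at this
    refine this.congr fun n => ?_
    have := hkpos n; have := hppos n; have := hτpos n
    rcases Nat.eq_zero_or_pos n with rfl | hn
    · simp
    · field_simp
  have h2 : ∀ᶠ n in atTop, 2 ≤ (p n : ℝ) * σ ^ 2 / (k n * τ n ^ 2) := by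
    filter_upwards [hinv.eventually_le_const (show (0 : ℝ) < 1 / 2 by norm_num)] with n h
    exact (one_div_le_one_div (hlpos n) (by norm_num)).1 h
  have hB := (h2.and (eventually_gt_atTop 0)).mono fun n h =>
    sup_bounds hK0 hK h.2 (hppos n) (hkpos n) hσ (hτpos n) rfl h.1
  have hmain : Tendsto (fun n : ℕ =>
        ((⨆ β : sparseSNRClass (p n) (k n) (τ n),
              regRisk n (p n) σ (fun ω => ridge ((p n : ℝ) * σ ^ 2 / (k n * τ n ^ 2)) ω.1 ω.2) β.1) /
            ((k n : ℝ) * τ n ^ 2) - 1) *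
          (((p n : ℝ) * σ ^ 2) / ((k n : ℝ) * τ n ^ 2)))
        atTop (nhds (-1)) := by
    refine tendsto_of_tendsto_of_tendsto_of_le_of_le' ?_ ?_ (hB.mono fun n h => h.1)
      (hB.mono fun n h => h.2)
    · simpa using (hc.const_mul 2).const_sub (-1)
    · simpa using (hc.const_mul 3).const_add (-1)
  refine ⟨?_, hmain⟩
  have := (hmain.mul hinv).add_const 1
  simp only [mul_zero, zero_add] at this
  refine this.congr fun n => ?_
  rw [mul_assoc, mul_one_div_cancel (hlpos n).ne']
  ring
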